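/- The special unitary group SU(8) is simply connected; in particular π₁(SU(8)) is trivial. -/

import Mathlib

open Set Topology

/-- Two paths with the same endpoints in a simply connected set are homotopic. -/
theorem IsSimplyConnected.homotopic_of_range_subset {X : Type*} [TopologicalSpace X] {s : Set X}
    (hs : IsSimplyConnected s) {x y : X} {p q : Path x y} (hp : range p ⊆ s) (hq : range q ⊆ s) :
    p.Homotopic q := by
  have := hs.simplyConnectedSpace
  have hp' : ∀ t, p t ∈ s := fun t => hp (mem_range_self t)
  have hq' : ∀ t, q t ∈ s := fun t => hq (mem_range_self t)
  have hx : x ∈ s := by simpa using hp' 0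
  have hy : y ∈ s := by simpa using hp' 1
  let lift (r : Path x y) (hr : ∀ t, r t ∈ s) : Path (⟨x, hx⟩ : s) ⟨y, hy⟩ :=
    { toFun := fun t => ⟨r t, hr t⟩
      source' := by simp
      target' := by simp }
  exact (SimplyConnectedSpace.paths_homotopic (lift p hp') (lift q hq')).map
    (⟨Subtype.val, continuous_subtype_val⟩ : C(s, X))

instance SimplyConnectedSpace.prod {X Y : Type*} [TopologicalSpace X] [TopologicalSpace Y]
    [SimplyConnectedSpace X] [SimplyConnectedSpace Y] : SimplyConnectedSpace (X × Y) := by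
  refine simply_connected_iff_paths_homotopic'.2 ⟨inferInstance, fun {x y} p q => ?_⟩
  obtain ⟨F⟩ := paths_homotopic (p.map continuous_fst) (q.map continuous_fst)
  obtain ⟨G⟩ := paths_homotopic (p.map continuous_snd) (q.map continuous_snd)
  exact ⟨Path.Homotopic.prodHomotopy F G⟩

/-- A weak form of the Seifert–van Kampen theorem: a space covered by simply connected open sets
with a common point and path-connected pairwise intersections is simply connected. -/
theorem SimplyConnectedSpace.of_isOpen_cover {X ι : Type*} [TopologicalSpace X] {c : ι → Set X}
    (hopen : ∀ i, IsOpen (c i)) (hcover : ⋃ i, c i = univ) (hc : ∀ i, IsSimplyConnected (c i))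
    (hinter : ∀ i j, IsPathConnected (c i ∩ c j)) {x₀ : X} (hx₀ : ∀ i, x₀ ∈ c i) :
    SimplyConnectedSpace X := by
  have hmem (x : X) : ∃ i, x ∈ c i := mem_iUnion.1 (hcover ▸ mem_univ x)
  have key {x y : X} (γ : Path x y) (hx : ∀ i, γ 0 ∈ c i) (i : ι) (δ : Path (γ 0) (γ 1))
      (hδ : range δ ⊆ c i) : (γ.subpath 0 1).Homotopic δ := by
    obtain ⟨t, ht0, htm, ⟨N, hN⟩, ht⟩ := exists_monotone_Icc_subset_open_cover_unitInterval
      (fun i => (hopen i).preimage γ.continuous)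
      (by rw [← preimage_iUnion, hcover, preimage_univ])
    suffices ∀ n i (δ : Path (γ 0) (γ (t n))), range δ ⊆ c i →
        (γ.subpath 0 (t n)).Homotopic δ by
      have h := this N i
      rw [hN N le_rfl] at h
      exact h δ hδ
    intro n
    induction n with
    | zero =>
      intro i
      rw [ht0]
      intro δ hδ
      rw [Path.subpath_self]
      refine (hc i).homotopic_of_range_subset ?_ hδ
      rintro _ ⟨s, rfl⟩
      exact hx i
    | succ n ih =>
      intro i δ hδ
      obtain ⟨j, hj⟩ := ht n
      have hle : t n ≤ t (n + 1) := htm n.le_succ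
      have hsub : range (γ.subpath (t n) (t (n + 1))) ⊆ c j := by
        rw [Path.range_subpath_of_le _ _ _ hle]
        exact image_subset_iff.2 hj
      have hi : γ (t (n + 1)) ∈ c i := by simpa using hδ (mem_range_self 1)
      obtain ⟨ε, hε⟩ := (hc j).isPathConnected.joinedIn _ (hx j) _ (hj (left_mem_Icc.2 hle))
      obtain ⟨η, hη⟩ := (hinter i j).joinedIn _ ⟨hx i, hx j⟩ _ ⟨hi, hj (right_mem_Icc.2 hle)⟩
      have hε' : range ε ⊆ c j := range_subset_iff.2 hε
      calc (γ.subpath 0 (t (n + 1))).Homotopic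
            ((γ.subpath 0 (t n)).trans (γ.subpath (t n) (t (n + 1)))) :=
            ⟨(Path.Homotopy.subpathTransSubpath γ _ _ _).symm⟩
        _ |>.Homotopic (ε.trans (γ.subpath (t n) (t (n + 1)))) :=
            (ih j ε hε').hcomp (.refl _)
        _ |>.Homotopic η := (hc j).homotopic_of_range_subset
            (by rw [Path.trans_range]; exact union_subset hε' hsub)
            (range_subset_iff.2 fun s => (hη s).2)
        _ |>.Homotopic δ := (hc i).homotopic_of_range_subset
            (range_subset_iff.2 fun s => (hη s).1) hδ
  have hjoined (x : X) : Joined x₀ x := by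
    obtain ⟨i, hi⟩ := hmem x
    exact ((hc i).isPathConnected.joinedIn _ (hx₀ i) _ hi).joined
  have : PathConnectedSpace X :=
    ⟨⟨x₀⟩, fun x y => (hjoined x).symm.trans (hjoined y)⟩
  have hsc (y : X) (p q : Path x₀ y) : p.Homotopic q := by
    obtain ⟨i, hi⟩ := hmem y
    obtain ⟨δ, hδ⟩ := (hc i).isPathConnected.joinedIn _ (hx₀ i) _ hi
    have hp (p : Path x₀ y) : p.Homotopic δ := by
      have h := key p (by simpa using hx₀) i (δ.cast p.source p.target) (range_subset_iff.2 hδ)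
      rw [Path.subpath_zero_one] at h
      obtain ⟨F⟩ := h
      exact ⟨F.cast rfl rfl⟩
    exact (hp p).trans (hp q).symm
  refine simply_connected_iff_paths_homotopic'.2 ⟨this, fun {x y} p q => ?_⟩
  obtain ⟨η⟩ := hjoined x
  have h := Path.Homotopic.Quotient.eq.2 (hsc y (η.trans p) (η.trans q))
  rw [← Path.Homotopic.Quotient.eq]
  simp only [Path.Homotopic.Quotient.mk_trans] at h
  have h' := congrArg (Path.Homotopic.Quotient.trans (Path.Homotopic.Quotient.mk η).symm) h
  simpa [← Path.Homotopic.Quotient.trans_assoc] using h'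

section

variable {G S : Type*} [Group G] [TopologicalSpace G] [IsTopologicalGroup G] [TopologicalSpace S]
  {p : G → S} {e : S}

/-- A local section over `C` of the orbit map `p` of a group acting on `S` trivialises `p`
over `C`. -/
def Homeomorph.preimageOfSection (hcont : Continuous p)
    (hp : ∀ g h, p g = p h ↔ p (g⁻¹ * h) = e) {C : Set S} {s : C → G} (hs : Continuous s)
    (hps : ∀ v, p (s v) = v) : p ⁻¹' C ≃ₜ C × {g // p g = e} where
  toFun g := (⟨p g, g.2⟩, ⟨(s ⟨p g, g.2⟩)⁻¹ * g, by rw [← hp, hps]⟩)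
  invFun x := ⟨s x.1 * x.2, by
    rw [mem_preimage, ← (hp (s x.1) _).2 (by simpa using x.2.2), hps]
    exact x.1.2⟩
  left_inv g := by simp
  right_inv x := by
    have h : p (s x.1 * x.2) = x.1 := by
      rw [← (hp (s x.1) _).2 (by simpa using x.2.2), hps]
    ext <;> simp [h]
  continuous_toFun := by fun_prop
  continuous_invFun := by fun_prop

/-- A topological group acting on `S` with simply connected stabilisers is simply connected if the
orbit map has sections over the complements of two points, these complements are simply connected
and their intersection is path connected. -/
theorem SimplyConnectedSpace.of_local_sections [T1Space S] (hcont : Continuous p)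
    (hp : ∀ g h, p g = p h ↔ p (g⁻¹ * h) = e) [SimplyConnectedSpace {g // p g = e}]
    {f : Bool → S} (hf : f false ≠ f true) (hC : ∀ i, IsSimplyConnected ({f i}ᶜ : Set S))
    (hC₂ : IsPathConnected ({f false}ᶜ ∩ {f true}ᶜ : Set S))
    (hsec : ∀ i, ∃ s : ({f i}ᶜ : Set S) → G, Continuous s ∧ ∀ v, p (s v) = v) :
    SimplyConnectedSpace G := by
  have hU (i : Bool) : IsSimplyConnected (p ⁻¹' {f i}ᶜ) := by
    obtain ⟨s, hs, hps⟩ := hsec i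
    have := (hC i).simplyConnectedSpace
    exact (Homeomorph.preimageOfSection hcont hp hs hps).toHomotopyEquiv.simplyConnectedSpace
  have hUV : IsPathConnected (p ⁻¹' {f false}ᶜ ∩ p ⁻¹' {f true}ᶜ) := by
    rw [← preimage_inter]
    obtain ⟨s, hs, hps⟩ := hsec false
    have := isPathConnected_iff_pathConnectedSpace.1 hC₂
    have Φ := Homeomorph.preimageOfSection (C := {f false}ᶜ ∩ {f true}ᶜ) hcont hp
      (s := fun v => s ⟨v, v.2.1⟩) (by fun_prop) (fun v => hps _)
    rw [isPathConnected_iff_pathConnectedSpace]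
    exact Φ.symm.surjective.pathConnectedSpace Φ.symm.continuous
  obtain ⟨x₀, hx₀⟩ := hUV.nonempty
  refine .of_isOpen_cover (c := fun i => p ⁻¹' {f i}ᶜ) (x₀ := x₀)
    (fun i => isOpen_compl_singleton.preimage hcont) ?_ hU ?_ (Bool.forall_bool.2 hx₀)
  · ext g
    simp only [mem_iUnion, Bool.exists_bool, mem_preimage, mem_compl_iff, mem_singleton_iff,
      mem_univ, iff_true]
    by_contra! h
    exact hf (h.1.symm.trans h.2)
  · simp only [Bool.forall_bool, inter_self]
    exact ⟨⟨(hU _).isPathConnected, hUV⟩, inter_comm (p ⁻¹' {f false}ᶜ) _ ▸ hUV,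
      (hU _).isPathConnected⟩

end

section Sphere

open Metric

variable {E : Type*} [NormedAddCommGroup E] [InnerProductSpace ℝ E]

/-- Stereographic projection as a homeomorphism. -/
noncomputable def Homeomorph.stereographic (v : sphere (0 : E) 1) :
    ({v}ᶜ : Set (sphere (0 : E) 1)) ≃ₜ (ℝ ∙ (v : E))ᗮ :=
  (_root_.stereographic (norm_eq_of_mem_sphere v)).toHomeomorphSourceTarget.trans
    (Homeomorph.Set.univ _)

theorem isSimplyConnected_compl_singleton_sphere (v : sphere (0 : E) 1) :
    IsSimplyConnected ({v}ᶜ : Set (sphere (0 : E) 1)) :=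
  (Homeomorph.stereographic v).toHomotopyEquiv.simplyConnectedSpace

theorem isPathConnected_compl_pair_sphere [FiniteDimensional ℝ E]
    (hE : 2 < Module.finrank ℝ E) (v : sphere (0 : E) 1) :
    IsPathConnected ({v}ᶜ ∩ {-v}ᶜ : Set (sphere (0 : E) 1)) := by
  let Φ := Homeomorph.stereographic v
  have hv : (v : E) ≠ 0 := ne_zero_of_mem_unit_sphere v
  have hr : 1 < Module.rank ℝ (ℝ ∙ (v : E))ᗮ := by
    have h := (ℝ ∙ (v : E)).finrank_add_finrank_orthogonal
    rw [finrank_span_singleton hv] at h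
    rw [← Module.finrank_eq_rank]
    exact_mod_cast (by omega : 1 < Module.finrank ℝ (ℝ ∙ (v : E))ᗮ)
  have hneg : -v ∈ ({v}ᶜ : Set (sphere (0 : E) 1)) :=
    (ne_neg_of_mem_unit_sphere ℝ v).symm
  have h := (isPathConnected_compl_singleton_of_one_lt_rank hr (Φ ⟨-v, hneg⟩)).image
    (continuous_subtype_val.comp Φ.symm.continuous)
  convert h using 1
  ext x
  constructor
  · rintro ⟨hx, hx'⟩
    exact ⟨Φ ⟨x, hx⟩, fun h => hx' (congrArg Subtype.val (Φ.injective h)), by simp⟩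
  · rintro ⟨y, hy, rfl⟩
    refine ⟨(Φ.symm y).2, fun h => hy ?_⟩
    rw [mem_singleton_iff, ← Φ.symm_apply_eq]
    exact Subtype.ext h

end Sphere

namespace Matrix

open Metric

instance {n R : Type*} [Fintype n] [DecidableEq n] [CommRing R] [StarRing R] [TopologicalSpace R]
    [IsTopologicalRing R] [ContinuousStar R] : IsTopologicalGroup (specialUnitaryGroup n R) where
  continuous_inv := continuous_induced_rng.2 continuous_subtype_val.star

instance {n R : Type*} [Fintype n] [DecidableEq n] [Subsingleton n] [CommRing R] [StarRing R] :
    Subsingleton (specialUnitaryGroup n R) := by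
  refine ⟨fun A B => Subtype.ext ?_⟩
  cases isEmpty_or_nonempty n
  · exact Subsingleton.elim _ _
  · ext i j
    have h (C : specialUnitaryGroup n R) : (C : Matrix n n R) i j = 1 := by
      rw [Subsingleton.elim j i]
      exact (det_eq_elem_of_subsingleton (C : Matrix n n R) i).symm.trans C.2.2
    exact (h A).trans (h B).symm

section Reindex

variable {m n R : Type*} [Fintype m] [Fintype n] [DecidableEq m] [DecidableEq n] [CommRing R]
  [StarRing R]

theorem reindex_mem_specialUnitaryGroup_iff (e : m ≃ n) {A : Matrix m m R} :
    reindex e e A ∈ specialUnitaryGroup n R ↔ A ∈ specialUnitaryGroup m R := by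
  rw [mem_specialUnitaryGroup_iff, mem_specialUnitaryGroup_iff, mem_unitaryGroup_iff,
    mem_unitaryGroup_iff, det_reindex_self, star_eq_conjTranspose, star_eq_conjTranspose,
    conjTranspose_reindex, reindex_apply, reindex_apply, submatrix_mul_equiv,
    ← (reindex e e).injective.eq_iff (b := 1)]
  simp

/-- Special unitary groups over equivalent index types are homeomorphic. -/
def specialUnitaryGroupReindex [TopologicalSpace R] (e : m ≃ n) :
    specialUnitaryGroup m R ≃ₜ specialUnitaryGroup n R where
  toEquiv := (reindex e e).subtypeEquiv fun _ => (reindex_mem_specialUnitaryGroup_iff e).symm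
  continuous_toFun := by
    refine continuous_induced_rng.2 ?_
    exact Continuous.matrix_submatrix continuous_subtype_val _ _
  continuous_invFun := by
    refine continuous_induced_rng.2 ?_
    exact Continuous.matrix_submatrix continuous_subtype_val _ _

end Reindex

section Stabilizer

variable {m n R : Type*} [Fintype m] [Unique m] [Fintype n] [DecidableEq m] [DecidableEq n]
  [CommRing R] [StarRing R]

theorem fromBlocks_one_mem_specialUnitaryGroup {B : Matrix n n R}
    (hB : B ∈ specialUnitaryGroup n R) :
    (fromBlocks 1 0 0 B : Matrix (m ⊕ n) (m ⊕ n) R) ∈ specialUnitaryGroup (m ⊕ n) R := by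
  rw [mem_specialUnitaryGroup_iff, mem_unitaryGroup_iff, star_eq_conjTranspose] at hB ⊢
  simp [fromBlocks_conjTranspose, fromBlocks_multiply, hB.1, hB.2]

theorem eq_fromBlocks_of_col_eq_single {A : Matrix (m ⊕ n) (m ⊕ n) R}
    (hA : A ∈ unitaryGroup (m ⊕ n) R) (h : A.col (.inl default) = Pi.single (.inl default) 1) :
    A = fromBlocks 1 0 0 A.toBlocks₂₂ := by
  have hcol (i) : A i (.inl default) = Pi.single (M := fun _ => R) (.inl default) 1 i :=
    congrFun h i
  have hrow (j) : A (.inl default) j = Pi.single (M := fun _ => R) (.inl default) 1 j := by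
    have := congrFun₂ (mem_unitaryGroup_iff'.1 hA) (.inl default) j
    simpa [star_eq_conjTranspose, mul_apply, hcol, Pi.single_apply, one_apply, eq_comm,
      apply_ite] using this
  ext (i | i) (j | j)
  · rw [Subsingleton.elim i default, Subsingleton.elim j default, hcol]
    simp
  · rw [Subsingleton.elim i default, hrow]
    simp
  · rw [Subsingleton.elim j default, hcol]
    simp
  · rfl

/-- The stabiliser of a basis vector in a special unitary group is the special unitary group of one
dimension less. -/
def specialUnitaryGroupStabilizer [TopologicalSpace R] :
    {A : specialUnitaryGroup (m ⊕ n) R // A.1.col (.inl default) = Pi.single (.inl default) 1} ≃ₜ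
      specialUnitaryGroup n R where
  toFun A := ⟨A.1.1.toBlocks₂₂, by
    have h := eq_fromBlocks_of_col_eq_single A.1.2.1 A.2
    obtain ⟨h₁, h₂⟩ := mem_specialUnitaryGroup_iff.1 A.1.2
    rw [h] at h₁ h₂
    rw [mem_unitaryGroup_iff, star_eq_conjTranspose, fromBlocks_conjTranspose,
      fromBlocks_multiply, ← fromBlocks_one, fromBlocks_inj] at h₁
    rw [det_fromBlocks_zero₂₁, det_one, one_mul] at h₂
    exact mem_specialUnitaryGroup_iff.2 ⟨mem_unitaryGroup_iff.2
      (by simpa [star_eq_conjTranspose] using h₁.2.2.2), h₂⟩⟩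
  invFun B := ⟨⟨fromBlocks 1 0 0 B, fromBlocks_one_mem_specialUnitaryGroup B.2⟩, by
    ext (i | i)
    · simp [Subsingleton.elim i default]
    · simp⟩
  left_inv A := Subtype.ext <| Subtype.ext (eq_fromBlocks_of_col_eq_single A.1.2.1 A.2).symm
  right_inv B := by simp
  continuous_toFun := by
    refine continuous_induced_rng.2 ?_
    exact Continuous.matrix_submatrix
      (continuous_subtype_val.comp continuous_subtype_val) Sum.inr Sum.inr
  continuous_invFun := by
    refine continuous_induced_rng.2 (continuous_induced_rng.2 ?_)
    exact Continuous.matrix_fromBlocks continuous_const continuous_const continuous_const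
      continuous_subtype_val

end Stabilizer

section UnitaryReflection

variable {n : Type*} [Fintype n]

variable {x y : n → ℂ}

theorem one_sub_star_dotProduct_ne_zero (hx : star x ⬝ᵥ x = 1) (hy : star y ⬝ᵥ y = 1)
    (hxy : x ≠ y) : 1 - star y ⬝ᵥ x ≠ 0 := by
  intro h
  have h₁ : star y ⬝ᵥ x = 1 := (sub_eq_zero.1 h).symm
  have h₂ : star x ⬝ᵥ y = 1 := by
    rw [star_dotProduct, h₁, star_one]
  open scoped ComplexOrder in
  refine hxy (sub_eq_zero.1 (dotProduct_star_self_eq_zero.1 ?_))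
  simp only [star_sub, sub_dotProduct, dotProduct_sub, h₁, h₂, hx, hy, sub_self]

variable [DecidableEq n]

/-- The complex reflection carrying the unit vector `x` to the unit vector `y ≠ x`. -/
noncomputable def unitaryReflection (x y : n → ℂ) : Matrix n n ℂ :=
  1 - (1 - star y ⬝ᵥ x)⁻¹ • vecMulVec (x - y) (star (x - y))

theorem unitaryReflection_mulVec (hx : star x ⬝ᵥ x = 1) (hy : star y ⬝ᵥ y = 1) (hxy : x ≠ y) :
    unitaryReflection x y *ᵥ x = y := by
  have h := one_sub_star_dotProduct_ne_zero hx hy hxy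
  have h' : star (x - y) ⬝ᵥ x = 1 - star y ⬝ᵥ x := by simp [sub_dotProduct, hx]
  rw [unitaryReflection, sub_mulVec, one_mulVec, smul_mulVec, vecMulVec_mulVec, h']
  ext i
  simp
  field_simp
  ring

theorem unitaryReflection_mem_unitaryGroup (hx : star x ⬝ᵥ x = 1) (hy : star y ⬝ᵥ y = 1)
    (hxy : x ≠ y) : unitaryReflection x y ∈ unitaryGroup n ℂ := by
  have h₁ := one_sub_star_dotProduct_ne_zero hx hy hxy
  have h₂ := one_sub_star_dotProduct_ne_zero hy hx hxy.symm
  have hc : star (1 - star y ⬝ᵥ x)⁻¹ = (1 - star x ⬝ᵥ y)⁻¹ := by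
    rw [star_inv₀, star_sub, star_one, ← star_dotProduct]
  have hw : star (x - y) ⬝ᵥ (x - y) = (1 - star y ⬝ᵥ x) + (1 - star x ⬝ᵥ y) := by
    simp only [star_sub, sub_dotProduct, dotProduct_sub, hx, hy]
    ring
  rw [mem_unitaryGroup_iff, unitaryReflection, star_eq_conjTranspose, conjTranspose_sub,
    conjTranspose_one, conjTranspose_smul, hc, conjTranspose_vecMulVec, star_star, mul_sub,
    sub_mul, sub_mul, smul_mul_smul_comm,
    vecMulVec_mul_vecMulVec, hw]
  ext i j
  simp
  field_simp
  ring

end UnitaryReflection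

section SphereSection

variable {n : Type*} [Fintype n] [DecidableEq n]

/-- A special unitary matrix with `a`-th column `v`, where `u` is a complex number of modulus one
and `v` is a unit vector other than `Pi.single a u`. -/
noncomputable def sphereSection (a b : n) (u : ℂ) (v : n → ℂ) : Matrix n n ℂ :=
  unitaryReflection (Pi.single a u) v * diagonal
    (Pi.mulSingle a u * Pi.mulSingle b (star (u * (unitaryReflection (Pi.single a u) v).det)))

variable {a b : n} {u : ℂ} {v : n → ℂ}

theorem sphereSection_mem_specialUnitaryGroup (hu : star u * u = 1) (hv : star v ⬝ᵥ v = 1)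
    (huv : Pi.single a u ≠ v) : sphereSection a b u v ∈ specialUnitaryGroup n ℂ := by
  have hR := unitaryReflection_mem_unitaryGroup (x := Pi.single a u) (by simpa) hv huv
  have hd := (Unitary.mem_iff.1 (det_of_mem_unitary hR)).1
  refine mem_specialUnitaryGroup_iff.2 ⟨mul_mem hR ?_, ?_⟩
  · rw [mem_unitaryGroup_iff', star_eq_conjTranspose, diagonal_conjTranspose, diagonal_mul_diagonal,
      ← diagonal_one]
    have hsingle (c i : n) (z : ℂ) (hz : star z * z = 1) :
        star (Pi.mulSingle (M := fun _ => ℂ) c z i) * Pi.mulSingle (M := fun _ => ℂ) c z i = 1 := by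
      obtain rfl | h := eq_or_ne i c
      · simpa using hz
      · simp [h]
    congr 1
    ext i
    simp only [Pi.star_apply, Pi.mul_apply]
    rw [star_mul]
    linear_combination hsingle b i (star (u * (unitaryReflection (Pi.single a u) v).det)) (by
      rw [star_star, star_mul]
      linear_combination star u * u * hd + hu) *
      (star (Pi.mulSingle (M := fun _ => ℂ) a u i) * Pi.mulSingle (M := fun _ => ℂ) a u i) +
        hsingle a i u hu
  · rw [sphereSection, det_mul, det_diagonal]
    simp only [Pi.mul_apply, Finset.prod_mul_distrib, Finset.prod_pi_mulSingle', Finset.mem_univ,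
      if_true, star_mul]
    linear_combination star u * u * hd + hu

theorem sphereSection_col (hab : a ≠ b) (hu : star u * u = 1) (hv : star v ⬝ᵥ v = 1)
    (huv : Pi.single a u ≠ v) : (sphereSection a b u v).col a = v := by
  rw [← mulVec_single_one, sphereSection, ← mulVec_mulVec, diagonal_mulVec_single]
  simpa [hab] using unitaryReflection_mulVec (x := Pi.single a u) (by simpa) hv huv

theorem continuous_sphereSection {T : Type*} [TopologicalSpace T] {v : T → n → ℂ}
    (hv : Continuous v) (hu : star u * u = 1) (hv₁ : ∀ t, star (v t) ⬝ᵥ v t = 1)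
    (huv : ∀ t, Pi.single a u ≠ v t) : Continuous fun t => sphereSection a b u (v t) := by
  have hR : Continuous fun t => unitaryReflection (Pi.single a u) (v t) := by
    refine continuous_const.sub (Continuous.fun_smul (Continuous.inv₀ ?_ fun t => ?_) ?_)
    · exact continuous_const.sub (hv.star.dotProduct continuous_const)
    · exact one_sub_star_dotProduct_ne_zero (by simpa) (hv₁ t) (huv t)
    · exact (continuous_const.sub hv).matrix_vecMulVec (continuous_const.sub hv).star
  refine hR.matrix_mul (Continuous.matrix_diagonal (continuous_const.mul ?_))
  exact (continuous_mulSingle b).comp (continuous_const.mul hR.matrix_det).star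

end SphereSection

section Sphere

variable {n : Type*} [Fintype n]

theorem toLp_mem_unitSphere_iff {v : n → ℂ} :
    WithLp.toLp 2 v ∈ sphere (0 : EuclideanSpace ℂ n) 1 ↔ star v ⬝ᵥ v = 1 := by
  have h : star v ⬝ᵥ v = (‖WithLp.toLp 2 v‖ : ℂ) ^ 2 := by
    rw [dotProduct_comm, ← EuclideanSpace.inner_toLp_toLp]
    exact inner_self_eq_norm_sq_to_K _
  rw [mem_sphere_zero_iff_norm, h]
  norm_cast
  exact (pow_eq_one_iff_of_nonneg (norm_nonneg _) two_ne_zero).symm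

variable [DecidableEq n]

theorem star_col_dotProduct_col {A : Matrix n n ℂ} (hA : A ∈ unitaryGroup n ℂ) (a : n) :
    star (A.col a) ⬝ᵥ A.col a = 1 := by
  simpa [star_eq_conjTranspose, mul_apply, dotProduct] using
    congrFun₂ (mem_unitaryGroup_iff'.1 hA) a a

/-- The orbit map of a basis vector under the special unitary group. -/
def specialUnitaryGroupCol (a : n) (A : specialUnitaryGroup n ℂ) :
    sphere (0 : EuclideanSpace ℂ n) 1 :=
  ⟨WithLp.toLp 2 (A.1.col a), toLp_mem_unitSphere_iff.2 (star_col_dotProduct_col A.2.1 a)⟩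

theorem specialUnitaryGroupCol_eq_iff {a : n} {A B : specialUnitaryGroup n ℂ} :
    specialUnitaryGroupCol a A = specialUnitaryGroupCol a B ↔ A.1.col a = B.1.col a :=
  Subtype.ext_iff.trans (WithLp.toLp_injective 2).eq_iff

theorem continuous_specialUnitaryGroupCol (a : n) :
    Continuous (specialUnitaryGroupCol a) := by
  refine continuous_induced_rng.2 ((PiLp.continuous_toLp 2 _).comp ?_)
  exact continuous_pi fun i => continuous_subtype_val.matrix_elem i a

theorem specialUnitaryGroup_simplyConnectedSpace_of_stabilizer {a b : n} (hab : a ≠ b)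
    [SimplyConnectedSpace {A : specialUnitaryGroup n ℂ // A.1.col a = Pi.single a 1}] :
    SimplyConnectedSpace (specialUnitaryGroup n ℂ) := by
  let e := specialUnitaryGroupCol a (1 : specialUnitaryGroup n ℂ)
  have he : e.1.ofLp = Pi.single a 1 := by
    ext i
    simp [e, specialUnitaryGroupCol, one_apply, Pi.single_apply]
  have hp (A B : specialUnitaryGroup n ℂ) :
      specialUnitaryGroupCol a A = specialUnitaryGroupCol a B ↔
        specialUnitaryGroupCol a (A⁻¹ * B) = e := by
    have hcol (C D : specialUnitaryGroup n ℂ) : (C * D).1.col a = C.1 *ᵥ D.1.col a := by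
      rw [← mulVec_single_one, ← mulVec_single_one, mulVec_mulVec]
      rfl
    rw [specialUnitaryGroupCol_eq_iff, specialUnitaryGroupCol_eq_iff, hcol]
    constructor
    · intro h
      rw [← h, ← hcol, inv_mul_cancel]
    · intro h
      rw [← mul_inv_cancel_left A B, hcol, hcol, h, ← hcol, mul_one]
  have : SimplyConnectedSpace {A // specialUnitaryGroupCol a A = e} :=
    (Homeomorph.subtype (q := fun A : specialUnitaryGroup n ℂ => A.1.col a = Pi.single a 1)
      (.refl _) fun A => by
        rw [← he]
        exact specialUnitaryGroupCol_eq_iff).toHomotopyEquiv.simplyConnectedSpace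
  have hdim : 2 < Module.finrank ℝ (EuclideanSpace ℂ n) := by
    have : 1 < Fintype.card n := Fintype.one_lt_card_iff.2 ⟨a, b, hab⟩
    rw [finrank_real_of_complex, finrank_euclideanSpace]
    omega
  have hsection (u : ℂ) (hu : star u * u = 1) (w : sphere (0 : EuclideanSpace ℂ n) 1)
      (hw : w.1.ofLp = Pi.single a u) : ∃ s : ({w}ᶜ : Set _) → specialUnitaryGroup n ℂ,
        Continuous s ∧ ∀ v, specialUnitaryGroupCol a (s v) = v := by
    have hv (v : ({w}ᶜ : Set _)) : star v.1.1.ofLp ⬝ᵥ v.1.1.ofLp = 1 :=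
      toLp_mem_unitSphere_iff.1 v.1.2
    have huv (v : ({w}ᶜ : Set _)) : Pi.single a u ≠ v.1.1.ofLp := fun h =>
      v.2 (Subtype.ext (WithLp.ofLp_injective 2 (h.symm.trans hw.symm)))
    refine ⟨fun v => ⟨sphereSection a b u v.1.1.ofLp,
      sphereSection_mem_specialUnitaryGroup hu (hv v) (huv v)⟩, ?_, fun v => ?_⟩
    · refine continuous_induced_rng.2 (continuous_sphereSection ?_ hu hv huv)
      exact (PiLp.continuous_ofLp 2 _).comp (continuous_subtype_val.comp continuous_subtype_val)
    · exact Subtype.ext (WithLp.ofLp_injective 2 (sphereSection_col hab hu (hv v) (huv v)))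
  refine .of_local_sections (f := fun i => cond i (-e) e) (continuous_specialUnitaryGroupCol a) hp
    (ne_neg_of_mem_unit_sphere ℝ e) (fun i => isSimplyConnected_compl_singleton_sphere _)
    (isPathConnected_compl_pair_sphere hdim e) ?_
  rw [Bool.forall_bool]
  exact ⟨hsection 1 (by simp) e he, hsection (-1) (by simp) (-e) (by simp [he, Pi.single_neg])⟩

end Sphere

theorem specialUnitaryGroup_simplyConnectedSpace (n : ℕ) :
    SimplyConnectedSpace (specialUnitaryGroup (Fin n) ℂ) := by
  induction n with
  | zero => infer_instance
  | succ n ih =>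
    cases n with
    | zero =>
      change SimplyConnectedSpace (specialUnitaryGroup (Fin 1) ℂ)
      infer_instance
    | succ n =>
      have := (specialUnitaryGroupStabilizer (m := Fin 1) (n := Fin (n + 1))
        (R := ℂ)).toHomotopyEquiv.simplyConnectedSpace
      have := specialUnitaryGroup_simplyConnectedSpace_of_stabilizer
        (a := (.inl default : Fin 1 ⊕ Fin (n + 1))) (b := .inr 0) Sum.inl_ne_inr
      exact (specialUnitaryGroupReindex (Fintype.equivOfCardEq (by simp [add_comm]) :
        Fin (n + 1 + 1) ≃ Fin 1 ⊕ Fin (n + 1))).toHomotopyEquiv.simplyConnectedSpace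

end Matrix

/-- The special unitary group `SU(8)` is simply connected. -/
theorem SU8_simplyConnected :
    SimplyConnectedSpace (Matrix.specialUnitaryGroup (Fin 8) ℂ) := by
  exact Matrix.specialUnitaryGroup_simplyConnectedSpace 8
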